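/- There exists a bounded, twice continuously differentiable function Q : [0,∞) → ℝ such that: (i) Q is non-negative, strictly decreasing, and convex on [0,∞); (ii) there is a constant M > 0 with −M ≤ Q'(x) < 0 for all x ≥ 0; (iii) Q'(0) = −p and for every x ≥ 0, (σ²/2)·Q''(x) − F(Q'(x)) − θ·x·Q'(x) − α·Q(x) = 0; consequently Q satisfies the Hamilton–Jacobi–Bellman equation inf_{u ≥ 0} { (σ²/2)·Q''(x) − u·Q'(x) + C(u) − θ·x·Q'(x) − α·Q(x) } = 0 for all x ≥ 0. -/

import Mathlib

open Set Filter

/-- The Legendre–Fenchel transform `F(y) = sup_{u ≥ 0} (u·y − C(u))`. -/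
noncomputable def LF (C : ℝ → ℝ) (y : ℝ) : ℝ :=
  sSup ((fun u => u * y - C u) '' Set.Ici (0 : ℝ))

lemma mvt_lo {f f' : ℝ → ℝ} {x x' c : ℝ} (h : x ≤ x')
    (hd : ∀ t ∈ Icc x x', HasDerivAt f (f' t) t) (hc : ∀ t ∈ Ioo x x', c ≤ f' t) :
    c * (x' - x) ≤ f x' - f x := by
  rcases h.eq_or_lt with rfl | h
  · simp
  · obtain ⟨t, ht, he⟩ := exists_hasDerivAt_eq_slope f f' h
      (fun t ht => (hd t ht).continuousAt.continuousWithinAt)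
      (fun t ht => hd t (Ioo_subset_Icc_self ht))
    have := hc t ht
    rwa [he, le_div_iff₀ (by linarith)] at this

lemma mvt_hi {f f' : ℝ → ℝ} {x x' c : ℝ} (h : x ≤ x')
    (hd : ∀ t ∈ Icc x x', HasDerivAt f (f' t) t) (hc : ∀ t ∈ Ioo x x', f' t ≤ c) :
    f x' - f x ≤ c * (x' - x) := by
  have := mvt_lo (f := fun t => - f t) (f' := fun t => - f' t) (c := -c) h
    (fun t ht => (hd t ht).neg) (fun t ht => by linarith [hc t ht])
  linarith

lemma cont_ind {f : ℝ → ℝ} {a b : ℝ} (hf : ContinuousOn f (Icc a b))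
    (h : ∀ x ∈ Icc a b, (∀ t ∈ Ico a x, 0 < f t) → 0 < f x) : ∀ x ∈ Icc a b, 0 < f x := by
  by_contra hcon
  push Not at hcon
  obtain ⟨x, hx, hfx⟩ := hcon
  have hcl : IsClosed (Icc a b ∩ f ⁻¹' (Iic 0)) := hf.preimage_isClosed_of_isClosed isClosed_Icc isClosed_Iic
  have hcomp : IsCompact (Icc a b ∩ f ⁻¹' (Iic 0)) :=
    isCompact_Icc.of_isClosed_subset hcl inter_subset_left
  obtain ⟨m, hm, hmin⟩ := hcomp.exists_isLeast ⟨x, hx, hfx⟩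
  have := h m hm.1 (fun t ht => by
    by_contra hh
    have := hmin (⟨⟨ht.1, ht.2.le.trans hm.1.2⟩, not_lt.1 hh⟩ : t ∈ Icc a b ∩ f ⁻¹' (Iic 0))
    linarith [ht.2])
  have h2 : f m ≤ 0 := hm.2
  linarith

noncomputable def clipR (R x : ℝ) : ℝ := max (-R) (min R x)

lemma clipR_abs_le {R : ℝ} (hR : 0 ≤ R) (x : ℝ) : |clipR R x| ≤ R ∧ |clipR R x| ≤ |x| := by
  unfold clipR
  constructor <;> grind

lemma clipR_lip (R : ℝ) : LipschitzWith 1 (clipR R) :=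
  (LipschitzWith.id.const_min R).const_max (-R)

lemma ivp (v : ℝ → ℝ × ℝ → ℝ × ℝ) (K : NNReal) (T : ℝ) (hT : 0 ≤ T)
    (hv : ∀ t ∈ Icc (-1) (T + 1), LipschitzWith K (v t)) (hc : ∀ z, Continuous (fun t => v t z))
    (z0 : ℝ × ℝ) : ∃ X : ℝ → ℝ × ℝ, X 0 = z0 ∧ ∀ t ∈ Icc 0 T, HasDerivAt X (v t (X t)) t := by
  obtain ⟨b, hb⟩ := (isCompact_Icc (a := (-1 : ℝ)) (b := T + 1)).exists_bound_of_continuousOn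
    (hc 0).continuousOn
  have hb0 : 0 ≤ b := (norm_nonneg _).trans (hb 0 ⟨by linarith, by linarith⟩)
  set R : ℝ := gronwallBound ‖z0‖ K b T with hRdef
  have hmono := gronwallBound_mono (norm_nonneg z0) hb0 K.2
  have hR : 0 ≤ R := by
    have := hmono hT
    rw [gronwallBound_x0] at this
    exact (norm_nonneg _).trans this
  set cl : ℝ × ℝ → ℝ × ℝ := fun z => (clipR R z.1, clipR R z.2) with hcl
  have hcl1 : ∀ z, ‖cl z‖ ≤ R := fun z => by
    rw [Prod.norm_def]; exact max_le (clipR_abs_le hR _).1 (clipR_abs_le hR _).1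
  have hcl2 : ∀ z, ‖cl z‖ ≤ ‖z‖ := fun z => by
    rw [Prod.norm_def, Prod.norm_def]
    exact max_le_max (clipR_abs_le hR _).2 (clipR_abs_le hR _).2
  have hcl3 : LipschitzWith 1 cl := by
    have := ((clipR_lip R).comp LipschitzWith.prod_fst).prodMk
      ((clipR_lip R).comp (LipschitzWith.prod_snd (α := ℝ) (β := ℝ)))
    simpa using this
  have hcl4 : ∀ z, ‖z‖ ≤ R → cl z = z := fun z hz => by
    rw [Prod.norm_def] at hz
    have h1 := abs_le.1 ((le_max_left _ _).trans hz)
    have h2 := abs_le.1 ((le_max_right _ _).trans hz)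
    simp only [hcl, clipR]
    ext
    · simp [min_eq_right h1.2, max_eq_right h1.1]
    · simp [min_eq_right h2.2, max_eq_right h2.1]
  have hbd : ∀ t ∈ Icc (-1) (T + 1), ∀ z, ‖v t z‖ ≤ K * ‖z‖ + b := fun t ht z => by
    have h1 := (hv t ht).dist_le_mul z 0
    rw [dist_eq_norm, dist_zero_right] at h1
    have h2 := hb t ht
    have h3 := norm_sub_norm_le (v t z) (v t 0)
    linarith
  set L : NNReal := ⟨K * R + b, by positivity⟩ with hL
  have hPL : IsPicardLindelof (fun t z => v t (cl z)) (tmin := -1) (tmax := T + 1)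
      ⟨0, by constructor <;> linarith⟩ z0 (L * Real.toNNReal (T + 1)) 0 L (K * 1) := by
    constructor
    · intro t ht
      exact ((hv t ht).comp hcl3).lipschitzOnWith
    · intro z _
      exact (hc _).continuousOn
    · intro t ht z _
      refine (hbd t ht _).trans ?_
      show _ ≤ K * R + b
      gcongr
      exact hcl1 z
    · simp only [NNReal.coe_zero, sub_zero]
      rw [NNReal.coe_mul, max_eq_left (by linarith), Real.coe_toNNReal _ (by linarith)]
  obtain ⟨X, hX0, hX⟩ := hPL.exists_eq_forall_mem_Icc_hasDerivWithinAt₀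
  have hX' : ∀ t ∈ Icc 0 T, HasDerivAt X (v t (cl (X t))) t := fun t ht =>
    (hX t ⟨by linarith [ht.1], by linarith [ht.2]⟩).hasDerivAt
      (Icc_mem_nhds (by linarith [ht.1]) (by linarith [ht.2]))
  refine ⟨X, hX0, fun t ht => ?_⟩
  have hg := norm_le_gronwallBound_of_norm_deriv_right_le (f := X) (f' := fun t => v t (cl (X t)))
    (δ := ‖z0‖) (K := K) (ε := b) (a := 0) (b := T)
    (fun t ht => (hX' t ht).continuousAt.continuousWithinAt)
    (fun t ht => (hX' t (Ico_subset_Icc_self ht)).hasDerivWithinAt) (by rw [← hX0])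
    (fun t ht => (hbd t ⟨by linarith [ht.1], by linarith [ht.2]⟩ _).trans (by
      gcongr; exact hcl2 _)) t ht
  rw [sub_zero] at hg
  have := hX' t ht
  rwa [hcl4 _ (hg.trans (hmono ht.2))] at this

noncomputable def vf (G : ℝ → ℝ) (s θ α t : ℝ) (z : ℝ × ℝ) : ℝ × ℝ :=
  (z.2, (G z.2 + θ * t * z.2 + α * z.1) / s)

lemma vf_lip {G : ℝ → ℝ} {k s θ α : ℝ} (hG : ∀ y y', |G y - G y'| ≤ k * |y - y'|) (hk : 0 ≤ k)
    (hs : 0 < s) (hθ : 0 < θ) (hα : 0 < α) (T : ℝ) (hT : 0 ≤ T) :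
    ∃ K : NNReal, ∀ t ∈ Icc (-1) (T + 1), LipschitzWith K (vf G s θ α t) := by
  have h0 : 0 ≤ 1 + (k + θ * (T + 1) + α) / s := by positivity
  refine ⟨⟨1 + (k + θ * (T + 1) + α) / s, h0⟩, fun t ht => LipschitzWith.of_dist_le_mul ?_⟩
  rintro ⟨q, y⟩ ⟨q', y'⟩
  have hd1 : |q - q'| ≤ dist (q, y) (q', y') := le_max_left _ _
  have hd2 : |y - y'| ≤ dist (q, y) (q', y') := le_max_right _ _
  have hd0 : 0 ≤ dist (q, y) (q', y') := dist_nonneg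
  set d := dist (q, y) (q', y')
  have ht' : |t| ≤ T + 1 := abs_le.2 ⟨by linarith [ht.1], ht.2⟩
  show max |y - y'| |(G y + θ * t * y + α * q) / s - (G y' + θ * t * y' + α * q') / s|
    ≤ (1 + (k + θ * (T + 1) + α) / s) * d
  have h1 : 0 ≤ (k + θ * (T + 1) + α) / s * d := by positivity
  apply max_le
  · linarith
  · rw [← sub_div, abs_div, abs_of_pos hs]
    have e : G y + θ * t * y + α * q - (G y' + θ * t * y' + α * q')
      = (G y - G y') + θ * t * (y - y') + α * (q - q') := by ring
    have h2 : |θ * t * (y - y')| ≤ θ * (T + 1) * d := by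
      rw [abs_mul, abs_mul, abs_of_pos hθ]; gcongr
    have h3 : |α * (q - q')| ≤ α * d := by
      rw [abs_mul, abs_of_pos hα]; gcongr
    have h4 : |G y - G y'| ≤ k * d := (hG y y').trans (by gcongr)
    have h5 : |(G y - G y') + θ * t * (y - y') + α * (q - q')| ≤ (k + θ * (T + 1) + α) * d := by
      refine (abs_add_le _ _).trans ?_
      have := abs_add_le (G y - G y') (θ * t * (y - y'))
      linarith
    rw [e]
    calc _ ≤ (k + θ * (T + 1) + α) * d / s := by gcongr
      _ = (k + θ * (T + 1) + α) / s * d := by ring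
      _ ≤ _ := by linarith

/-- once `y' < 0` and `y ≤ 0` at `x0`, `y' < 0` afterwards -/
lemma desc {G Q y : ℝ → ℝ} {s θ α x0 N : ℝ} (hGc : Continuous G) (hGm : Monotone G)
    (hs : 0 < s) (hθ : 0 < θ) (hα : 0 < α) (hx0 : 0 ≤ x0)
    (hQ : ∀ t ∈ Icc x0 N, HasDerivAt Q (y t) t)
    (hy : ∀ t ∈ Icc x0 N, HasDerivAt y ((G (y t) + θ * t * y t + α * Q t) / s) t)
    (h0 : y x0 ≤ 0) (h1 : G (y x0) + θ * x0 * y x0 + α * Q x0 < 0) :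
    ∀ x ∈ Icc x0 N, 0 < -(G (y x) + θ * x * y x + α * Q x) := by
  have hcy : ContinuousOn y (Icc x0 N) := fun t ht => (hy t ht).continuousAt.continuousWithinAt
  have hcQ : ContinuousOn Q (Icc x0 N) := fun t ht => (hQ t ht).continuousAt.continuousWithinAt
  refine cont_ind ?_ ?_
  · have := hGc.comp_continuousOn hcy
    have h2 : ContinuousOn (fun x => G (y x)) (Icc x0 N) := this
    fun_prop
  · intro x hx hlt
    have hsub : ∀ x' ∈ Icc x0 x, y x' ≤ y x0 := fun x' hx' => by
      have := mvt_hi (f := y) (c := 0) hx'.1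
        (fun t ht => hy t ⟨ht.1, ht.2.trans (hx'.2.trans hx.2)⟩) (fun t ht => by
          have := hlt t ⟨ht.1.le, ht.2.trans_le hx'.2⟩
          exact div_nonpos_of_nonpos_of_nonneg (by linarith) hs.le)
      linarith
    have hyx := hsub x ⟨hx.1, le_rfl⟩
    have hQx : Q x ≤ Q x0 := by
      have := mvt_hi (f := Q) (c := 0) hx.1
        (fun t ht => hQ t ⟨ht.1, ht.2.trans hx.2⟩) (fun t ht =>
          (hsub t (Ioo_subset_Icc_self ht)).trans h0)
      linarith
    have h3 : G (y x) ≤ G (y x0) := hGm hyx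
    have h4 : x * y x ≤ x0 * y x0 := by
      have : x * y x ≤ x * y x0 := mul_le_mul_of_nonneg_left hyx (hx0.trans hx.1)
      have : x * y x0 ≤ x0 * y x0 := mul_le_mul_of_nonpos_right hx.1 h0
      linarith
    have h5 : θ * (x * y x) ≤ θ * (x0 * y x0) := by gcongr
    have h6 : α * Q x ≤ α * Q x0 := by gcongr
    nlinarith

lemma shoot {G : ℝ → ℝ} {k c s θ α p N : ℝ} (hG : ∀ y y', |G y - G y'| ≤ k * |y - y'|) (hk : 0 ≤ k)
    (hGc : Continuous G) (hGm : Monotone G) (hGl : ∀ y, -c ≤ G y) (hGu : ∀ y ≤ 0, G y ≤ 0)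
    (hs : 0 < s) (hθ : 0 < θ) (hα : 0 < α) (hp : 0 < p) (hN : 1 ≤ N) :
    ∃ Q y : ℝ → ℝ, y 0 = -p ∧ y N = 0 ∧ (∀ t ∈ Icc 0 N, HasDerivAt Q (y t) t) ∧
      (∀ t ∈ Icc 0 N, HasDerivAt y ((G (y t) + θ * t * y t + α * Q t) / s) t) := by
  have hN0 : 0 ≤ N := by linarith
  obtain ⟨K, hK⟩ := vf_lip hG hk hs hθ hα N hN0
  have hc : ∀ z, Continuous (fun t => vf G s θ α t z) := fun z => by
    unfold vf; fun_prop
  choose X hX0 hX using fun a : ℝ => ivp (vf G s θ α) K N hN0 hK hc (a, -p)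
  have hQ : ∀ a, ∀ t ∈ Icc 0 N, HasDerivAt (fun t => (X a t).1) (X a t).2 t :=
    fun a t ht => by
      exact (ContinuousLinearMap.fst ℝ ℝ ℝ).hasFDerivAt.comp_hasDerivAt t (hX a t ht)
  have hy : ∀ a, ∀ t ∈ Icc 0 N, HasDerivAt (fun t => (X a t).2)
      ((G (X a t).2 + θ * t * (X a t).2 + α * (X a t).1) / s) t :=
    fun a t ht => by
      exact (ContinuousLinearMap.snd ℝ ℝ ℝ).hasFDerivAt.comp_hasDerivAt t (hX a t ht)
  have hcont : Continuous (fun a => (X a N).2) := by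
    have hdist : ∀ a b, dist (X a N) (X b N) ≤ dist a b * Real.exp (K * (N - 0)) := fun a b => by
      refine dist_le_of_trajectories_ODE_of_mem (v := vf G s θ α) (K := K) (s := fun _ => univ)
        (a := 0) (b := N) ?_ ?_ ?_ ?_ ?_ ?_ ?_ ?_ N ⟨hN0, le_rfl⟩
      · intro t ht
        exact (hK t ⟨by linarith [ht.1], by linarith [ht.2]⟩).lipschitzOnWith
      · exact fun t ht => (hX a t ht).continuousAt.continuousWithinAt
      · exact fun t ht => (hX a t (Ico_subset_Icc_self ht)).hasDerivWithinAt
      · exact fun _ _ => trivial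
      · exact fun t ht => (hX b t ht).continuousAt.continuousWithinAt
      · exact fun t ht => (hX b t (Ico_subset_Icc_self ht)).hasDerivWithinAt
      · exact fun _ _ => trivial
      · rw [hX0, hX0, Prod.dist_eq]; simp
    have : LipschitzWith (Real.toNNReal (Real.exp (K * (N - 0)))) (fun a => X a N) :=
      LipschitzWith.of_dist_le_mul fun a b => by
        rw [Real.coe_toNNReal _ (Real.exp_pos _).le, mul_comm]; exact hdist a b
    exact continuous_snd.comp this.continuous
  have hlow : (X (-1) N).2 ≤ 0 := by
    have e0 : (X (-1) 0) = (-1, -p) := hX0 _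
    have hd := desc (x0 := 0) (N := N) hGc hGm hs hθ hα le_rfl (hQ (-1)) (hy (-1))
      (by simp only [e0]; linarith)
      (by simp only [e0]; have := hGu (-p) (by linarith); linarith)
    have := mvt_hi (f := fun t => (X (-1) t).2) (c := 0) hN0 (hy (-1)) (fun t ht => by
      have := hd t (Ioo_subset_Icc_self ht)
      exact div_nonpos_of_nonpos_of_nonneg (by linarith) hs.le)
    simp only [e0] at this
    linarith
  obtain ⟨a, ha⟩ : ∃ a, a = (s * p + c + θ * N * p + α * (p * N)) / α := ⟨_, rfl⟩
  have ha' : α * a = s * p + c + θ * N * p + α * (p * N) := by rw [ha]; field_simp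
  have hhigh : 0 ≤ (X a N).2 := by
    have e0 : (X a 0) = (a, -p) := hX0 _
    have hcy : ContinuousOn (fun t => (X a t).2) (Icc 0 N) :=
      fun t ht => (hy a t ht).continuousAt.continuousWithinAt
    have hcQ : ContinuousOn (fun t => (X a t).1) (Icc 0 N) :=
      fun t ht => (hQ a t ht).continuousAt.continuousWithinAt
    have key : ∀ x ∈ Icc 0 N, (∀ t ∈ Ico 0 x,
        0 < G (X a t).2 + θ * t * (X a t).2 + α * (X a t).1) →
        s * p ≤ G (X a x).2 + θ * x * (X a x).2 + α * (X a x).1 := by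
      intro x hx hlt
      have hsub : ∀ x' ∈ Icc 0 x, -p ≤ (X a x').2 := fun x' hx' => by
        have := mvt_lo (f := fun t => (X a t).2) (c := 0) hx'.1
          (fun t ht => hy a t ⟨ht.1, ht.2.trans (hx'.2.trans hx.2)⟩) (fun t ht => by
            have := hlt t ⟨ht.1.le, ht.2.trans_le hx'.2⟩
            positivity)
        simp only [e0] at this
        linarith
      have hQx := mvt_lo (f := fun t => (X a t).1) (c := -p) hx.1
        (fun t ht => hQ a t ⟨ht.1, ht.2.trans hx.2⟩) (fun t ht =>
          (hsub t (Ioo_subset_Icc_self ht)))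
      simp only [e0] at hQx
      have hyx := hsub x ⟨hx.1, le_rfl⟩
      have h1 := hGl (X a x).2
      have h2 : x * (X a x).2 ≥ - (N * p) := by
        have : x * (-p) ≤ x * (X a x).2 := mul_le_mul_of_nonneg_left hyx hx.1
        have : x * p ≤ N * p := by have := hx.2; gcongr
        linarith
      have h3 : θ * (x * (X a x).2) ≥ θ * (- (N * p)) := by gcongr
      have h4 : (X a x).1 ≥ a - p * N := by
        have : p * x ≤ p * N := by have := hx.2; gcongr
        linarith
      have h5 : α * (X a x).1 ≥ α * (a - p * N) := by gcongr
      linarith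
    have hpos := cont_ind (f := fun t => G (X a t).2 + θ * t * (X a t).2 + α * (X a t).1)
      (a := 0) (b := N) (by
        have h2 : ContinuousOn (fun x => G (X a x).2) (Icc 0 N) := hGc.comp_continuousOn hcy
        fun_prop) (fun x hx hlt => lt_of_lt_of_le (by positivity) (key x hx hlt))
    have := mvt_lo (f := fun t => (X a t).2) (c := p) hN0 (hy a) (fun t ht => by
      have := key t (Ioo_subset_Icc_self ht) (fun r hr => hpos r ⟨hr.1, hr.2.le.trans ht.2.le⟩)
      rw [le_div_iff₀ hs]; linarith)
    simp only [e0] at this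
    nlinarith
  obtain ⟨a', ha'⟩ := mem_range_of_exists_le_of_exists_ge hcont ⟨-1, hlow⟩ ⟨a, hhigh⟩
  refine ⟨fun t => (X a' t).1, fun t => (X a' t).2, ?_, ha', hQ a', hy a'⟩
  simp [hX0]

lemma bvp {G : ℝ → ℝ} {k c s θ α p N : ℝ} (hG : ∀ y y', |G y - G y'| ≤ k * |y - y'|) (hk : 0 ≤ k)
    (hGc : Continuous G) (hGm : Monotone G) (hGl : ∀ y, -c ≤ G y) (hGu : ∀ y ≤ 0, G y ≤ 0)
    (hs : 0 < s) (hθ : 0 < θ) (hα : 0 < α) (hp : 0 < p) (hN : 1 ≤ N) :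
    ∃ Q y : ℝ → ℝ, y 0 = -p ∧ (∀ t ∈ Icc 0 N, HasDerivAt Q (y t) t) ∧
      (∀ t ∈ Icc 0 N, HasDerivAt y ((G (y t) + θ * t * y t + α * Q t) / s) t) ∧
      (∀ t ∈ Icc 0 N, 0 ≤ G (y t) + θ * t * y t + α * Q t) ∧
      (∀ t ∈ Icc 0 N, y t ∈ Icc (-p) 0) ∧
      (∀ t ∈ Icc 0 N, Q t ∈ Icc 0 ((s * p + c + θ * p + α * p) / α)) := by
  obtain ⟨Q, y, hy0, hyN, hQ, hy⟩ := shoot hG hk hGc hGm hGl hGu hs hθ hα hp hN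
  have hN0 : 0 ≤ N := by linarith
  have hcy : ContinuousOn y (Icc 0 N) := fun t ht => (hy t ht).continuousAt.continuousWithinAt
  have hcQ : ContinuousOn Q (Icc 0 N) := fun t ht => (hQ t ht).continuousAt.continuousWithinAt
  have hcg : ContinuousOn (fun x => G (y x) + θ * x * y x + α * Q x) (Icc 0 N) := by
    have h2 : ContinuousOn (fun x => G (y x)) (Icc 0 N) := hGc.comp_continuousOn hcy
    fun_prop
  have claim : ∀ x ∈ Ico 0 N, y x ≤ 0 → 0 ≤ G (y x) + θ * x * y x + α * Q x := by
    intro x hx hyx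
    by_contra hcon
    push Not at hcon
    have hd := desc (x0 := x) (N := N) hGc hGm hs hθ hα hx.1
      (fun t ht => hQ t ⟨hx.1.trans ht.1, ht.2⟩) (fun t ht => hy t ⟨hx.1.trans ht.1, ht.2⟩) hyx hcon
    have hxN : x < N := hx.2
    have h2 : ∃ r ∈ Ioo x N, (G (y r) + θ * r * y r + α * Q r) / s = (y N - y x) / (N - x) :=
      exists_hasDerivAt_eq_slope y (fun r => (G (y r) + θ * r * y r + α * Q r) / s) hxN
        (hcy.mono (Icc_subset_Icc_left hx.1))
        (fun t ht => hy t ⟨hx.1.trans ht.1.le, ht.2.le⟩)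
    obtain ⟨r, hr, he⟩ := h2
    have h3 := hd r (Ioo_subset_Icc_self hr)
    have h4 : (G (y r) + θ * r * y r + α * Q r) / s < 0 := div_neg_of_neg_of_pos (by linarith) hs
    rw [he] at h4
    have : 0 ≤ (y N - y x) / (N - x) := div_nonneg (by linarith) (by linarith)
    linarith
  have hyle : ∀ t ∈ Icc 0 N, y t ≤ 0 := by
    obtain ⟨m, hm, hmax⟩ := isCompact_Icc.exists_isMaxOn (nonempty_Icc.2 hN0) hcy
    by_contra hcon
    push Not at hcon
    obtain ⟨t, ht, hyt⟩ := hcon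
    have hym : 0 < y m := lt_of_lt_of_le hyt (hmax ht)
    have hmN : m < N := lt_of_le_of_ne hm.2 (by rintro rfl; linarith)
    have hcl : IsClosed (Icc 0 m ∩ y ⁻¹' (Iic 0)) :=
      (hcy.mono (Icc_subset_Icc_right hm.2)).preimage_isClosed_of_isClosed isClosed_Icc isClosed_Iic
    have hcomp : IsCompact (Icc 0 m ∩ y ⁻¹' (Iic 0)) :=
      isCompact_Icc.of_isClosed_subset hcl inter_subset_left
    obtain ⟨x0, ⟨hx0, hyx0'⟩, hgr⟩ := hcomp.exists_isGreatest
      ⟨0, ⟨le_rfl, hm.1⟩, by show y 0 ≤ 0; linarith⟩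
    have hyx0 : y x0 ≤ 0 := hyx0'
    have hx0m : x0 < m := lt_of_le_of_ne hx0.2 (by rintro rfl; linarith)
    have hgt : ∀ r ∈ Ioo x0 m, 0 ≤ y r := fun r hr => by
      by_contra hh
      have := hgr (⟨⟨hx0.1.trans hr.1.le, hr.2.le⟩, (not_le.1 hh).le⟩ : r ∈ Icc 0 m ∩ y ⁻¹' (Iic 0))
      linarith [hr.1]
    have hQm := mvt_lo (f := Q) (c := 0) hx0m.le
      (fun r hr => hQ r ⟨hx0.1.trans hr.1, hr.2.trans hm.2⟩) hgt
    have h1 := claim x0 ⟨hx0.1, hx0m.trans hmN⟩ hyx0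
    have hm0 : 0 < m := lt_of_le_of_lt hx0.1 hx0m
    have hloc : IsLocalMax y m := hmax.isLocalMax (Icc_mem_nhds hm0 hmN)
    have h2 := hloc.hasDerivAt_eq_zero (hy m hm)
    rw [div_eq_zero_iff] at h2
    have h3 := h2.resolve_right hs.ne'
    have h4 : G (y x0) ≤ G (y m) := hGm (by linarith)
    have h5 : 0 < θ * m * y m := by positivity
    have h6 : θ * x0 * y x0 ≤ 0 :=
      mul_nonpos_of_nonneg_of_nonpos (mul_nonneg hθ.le hx0.1) hyx0
    have h7 : α * Q x0 ≤ α * Q m := mul_le_mul_of_nonneg_left (by linarith) hα.le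
    linarith
  have hg0 : ∀ t ∈ Icc 0 N, 0 ≤ G (y t) + θ * t * y t + α * Q t := by
    have hcl : closure (Ico 0 N) = Icc 0 N := closure_Ico (by linarith)
    intro t ht
    refine le_on_closure (s := Ico 0 N) (f := fun _ => (0 : ℝ)) (fun x hx =>
      claim x hx (hyle x (Ico_subset_Icc_self hx))) continuousOn_const (by rw [hcl]; exact hcg)
      (by rw [hcl]; exact ht)
  have hym : ∀ t ∈ Icc 0 N, -p ≤ y t := fun t ht => by
    have := mvt_lo (f := y) (c := 0) ht.1 (fun r hr => hy r ⟨hr.1, hr.2.trans ht.2⟩)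
      (fun r hr => div_nonneg (hg0 r ⟨hr.1.le, hr.2.le.trans ht.2⟩) hs.le)
    linarith
  refine ⟨Q, y, hy0, hQ, hy, hg0, fun t ht => ⟨hym t ht, hyle t ht⟩, fun t ht => ⟨?_, ?_⟩⟩
  · have h1 := hg0 N ⟨hN0, le_rfl⟩
    rw [hyN] at h1
    have h2 := hGu 0 le_rfl
    have h3 : 0 ≤ Q N := by
      have : 0 ≤ α * Q N := by linarith
      exact nonneg_of_mul_nonneg_right this hα
    have := mvt_hi (f := Q) (c := 0) ht.2 (fun r hr => hQ r ⟨ht.1.trans hr.1, hr.2⟩)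
      (fun r hr => hyle r ⟨ht.1.trans hr.1.le, hr.2.le⟩)
    linarith
  · have h1 := mvt_hi (f := Q) (c := 0) ht.1 (fun r hr => hQ r ⟨hr.1, hr.2.trans ht.2⟩)
      (fun r hr => hyle r ⟨hr.1.le, hr.2.le.trans ht.2⟩)
    obtain ⟨r, hr, he⟩ : ∃ r ∈ Ioo (0 : ℝ) 1,
        (G (y r) + θ * r * y r + α * Q r) / s = (y 1 - y 0) / (1 - 0) :=
      exists_hasDerivAt_eq_slope y (fun r => (G (y r) + θ * r * y r + α * Q r) / s) one_pos
        (hcy.mono (Icc_subset_Icc_right hN))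
        (fun t ht => hy t ⟨ht.1.le, ht.2.le.trans hN⟩)
    have hrN : r ∈ Icc 0 N := ⟨hr.1.le, hr.2.le.trans hN⟩
    have h2 := mvt_lo (f := Q) (c := -p) hr.1.le (fun t ht => hQ t ⟨ht.1, ht.2.trans hrN.2⟩)
      (fun t ht => hym t ⟨ht.1.le, ht.2.le.trans hrN.2⟩)
    have h3 := hyle 1 ⟨by norm_num, hN⟩
    have h4 : (G (y r) + θ * r * y r + α * Q r) / s ≤ p := by
      rw [he, hy0]; linarith
    rw [div_le_iff₀ hs] at h4
    have h5 := hGl (y r)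
    have h6 : r * y r ≥ -p := by
      nlinarith [hym r hrN, hr.1, hr.2]
    have h7 : θ * (r * y r) ≥ θ * (-p) := by gcongr
    have h8 : Q r ≥ Q 0 - p := by nlinarith [hr.1, hr.2]
    have h9 : α * Q r ≥ α * (Q 0 - p) := by gcongr
    rw [le_div_iff₀ hα]
    nlinarith

noncomputable def FN (C : ℝ → ℝ) (n : ℝ) (y : ℝ) : ℝ :=
  sSup ((fun u => u * y - C u) '' Set.Icc (0 : ℝ) n)

section FNfacts
variable {C : ℝ → ℝ} (hC : ∀ u ≥ 0, 0 ≤ C u)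

lemma FN_bdd (hC : ∀ u ≥ 0, 0 ≤ C u) (n y : ℝ) :
    BddAbove ((fun u => u * y - C u) '' Set.Icc (0 : ℝ) n) := by
  refine ⟨n * |y|, ?_⟩
  rintro _ ⟨u, hu, rfl⟩
  have h1 := hC u hu.1
  have h2 : u * y ≤ u * |y| := mul_le_mul_of_nonneg_left (le_abs_self y) hu.1
  have h3 : u * |y| ≤ n * |y| := mul_le_mul_of_nonneg_right hu.2 (abs_nonneg y)
  show u * y - C u ≤ n * |y|
  linarith

lemma le_FN (hC : ∀ u ≥ 0, 0 ≤ C u) {n y u : ℝ} (hu : u ∈ Icc 0 n) : u * y - C u ≤ FN C n y :=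
  le_csSup (FN_bdd hC n y) ⟨u, hu, rfl⟩

lemma FN_le {n y c : ℝ} (hn : 0 ≤ n) (h : ∀ u ∈ Icc 0 n, u * y - C u ≤ c) : FN C n y ≤ c := by
  apply csSup_le ((nonempty_Icc.2 hn).image _)
  rintro _ ⟨u, hu, rfl⟩
  exact h u hu

lemma FN_mono (hC : ∀ u ≥ 0, 0 ≤ C u) {n : ℝ} (hn : 0 ≤ n) : Monotone (FN C n) := by
  intro y y' h
  refine FN_le hn fun u hu => le_trans ?_ (le_FN hC hu)
  have := mul_le_mul_of_nonneg_left h hu.1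
  linarith

lemma FN_lip (hC : ∀ u ≥ 0, 0 ≤ C u) {n : ℝ} (hn : 0 ≤ n) (y y' : ℝ) :
    |FN C n y - FN C n y'| ≤ n * |y - y'| := by
  have key : ∀ y y', FN C n y ≤ FN C n y' + n * |y - y'| := by
    intro y y'
    refine FN_le hn fun u hu => ?_
    have h1 := le_FN hC (y := y') hu
    have h2 : u * (y - y') ≤ u * |y - y'| := mul_le_mul_of_nonneg_left (le_abs_self _) hu.1
    have h3 : u * |y - y'| ≤ n * |y - y'| := mul_le_mul_of_nonneg_right hu.2 (abs_nonneg _)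
    linarith
  have h1 := key y y'
  have h2 := key y' y
  rw [abs_sub_comm y' y] at h2
  rw [abs_le]; constructor <;> linarith

lemma FN_cont (hC : ∀ u ≥ 0, 0 ≤ C u) {n : ℝ} (hn : 0 ≤ n) : Continuous (FN C n) := by
  have : LipschitzWith (Real.toNNReal n) (FN C n) := LipschitzWith.of_dist_le_mul fun y y' => by
    rw [Real.coe_toNNReal _ hn]; exact FN_lip hC hn y y'
  exact this.continuous

lemma FN_lb (hC : ∀ u ≥ 0, 0 ≤ C u) {n : ℝ} (hn : 0 ≤ n) (y : ℝ) : -C 0 ≤ FN C n y := by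
  have := le_FN hC (y := y) (⟨le_rfl, hn⟩ : (0:ℝ) ∈ Icc 0 n)
  linarith

lemma FN_ub (hC : ∀ u ≥ 0, 0 ≤ C u) {n : ℝ} (hn : 0 ≤ n) {y : ℝ} (hy : y ≤ 0) : FN C n y ≤ 0 :=
  FN_le hn fun u hu => by
    have := hC u hu.1
    have := mul_nonpos_of_nonneg_of_nonpos hu.1 hy
    linarith

lemma LF_bdd (hC : ∀ u ≥ 0, 0 ≤ C u) {y : ℝ} (hy : y ≤ 0) :
    BddAbove ((fun u => u * y - C u) '' Set.Ici (0 : ℝ)) := by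
  refine ⟨0, ?_⟩
  rintro _ ⟨u, hu, rfl⟩
  have := hC u hu
  have := mul_nonpos_of_nonneg_of_nonpos hu hy
  show u * y - C u ≤ 0
  linarith

lemma le_LF (hC : ∀ u ≥ 0, 0 ≤ C u) {y u : ℝ} (hy : y ≤ 0) (hu : 0 ≤ u) : u * y - C u ≤ LF C y :=
  le_csSup (LF_bdd hC hy) ⟨u, hu, rfl⟩

lemma LF_le {y c : ℝ} (h : ∀ u ≥ 0, u * y - C u ≤ c) : LF C y ≤ c := by
  apply csSup_le (nonempty_Ici.image _)
  rintro _ ⟨u, hu, rfl⟩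
  exact h u hu

lemma LF_ub (hC : ∀ u ≥ 0, 0 ≤ C u) {y : ℝ} (hy : y ≤ 0) : LF C y ≤ 0 :=
  LF_le fun u hu => by
    have := hC u hu
    have := mul_nonpos_of_nonneg_of_nonpos hu hy
    linarith

lemma FN_le_LF (hC : ∀ u ≥ 0, 0 ≤ C u) {n : ℝ} (hn : 0 ≤ n) {y : ℝ} (hy : y ≤ 0) :
    FN C n y ≤ LF C y := FN_le hn fun _ hu => le_LF hC hy hu.1

lemma LF_le_FN (hC : ∀ u ≥ 0, 0 ≤ C u) {n : ℝ} (hn : 0 ≤ n) {y : ℝ} (hy : y ≤ 0) :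
    LF C y ≤ FN C n y + C n := LF_le fun u hu => by
  rcases le_total u n with h | h
  · have := le_FN hC (y := y) (⟨hu, h⟩ : u ∈ Icc 0 n)
    have := hC n hn
    linarith
  · have := le_FN hC (y := y) (⟨hn, le_rfl⟩ : n ∈ Icc 0 n)
    have := hC u hu
    have := mul_le_mul_of_nonpos_right h hy
    linarith

lemma LF_zero (hC : ∀ u ≥ 0, 0 ≤ C u) (hlim : Tendsto C atTop (nhds 0)) : LF C 0 = 0 := by
  apply le_antisymm (LF_ub hC le_rfl)
  have h1 : ∀ᶠ u in atTop, -C u ≤ LF C 0 := by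
    filter_upwards [eventually_ge_atTop (0:ℝ)] with u hu
    have := le_LF hC (le_refl (0:ℝ)) hu
    linarith
  have h2 := hlim.neg
  rw [neg_zero] at h2
  exact le_of_tendsto h2 h1

lemma LF_cont (hC : ∀ u ≥ 0, 0 ≤ C u) (hlim : Tendsto C atTop (nhds 0)) :
    ContinuousOn (LF C) (Iic 0) := by
  have hu : TendstoUniformlyOn (fun (n : ℝ) => FN C n) (LF C) atTop (Iic 0) := by
    rw [Metric.tendstoUniformlyOn_iff]
    intro ε hε
    filter_upwards [hlim.eventually (gt_mem_nhds hε), eventually_ge_atTop (0:ℝ)] with n hn hn0 y hy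
    have h1 := FN_le_LF hC hn0 hy
    have h2 := LF_le_FN hC hn0 hy
    rw [Real.dist_eq, abs_lt]; constructor <;> linarith
  exact hu.continuousOn (Eventually.frequently (by
    filter_upwards [eventually_ge_atTop (0:ℝ)] with n hn
    exact (FN_cont hC hn).continuousOn))

end FNfacts

/-- The limit object -/
lemma limit_exists {C : ℝ → ℝ} {s θ α p : ℝ} (hC : ∀ u ≥ 0, 0 ≤ C u)
    (hlim : Tendsto C atTop (nhds 0)) (hs : 0 < s) (hθ : 0 < θ) (hα : 0 < α) (hp : 0 < p) :
    ∃ (B : ℝ) (Q y : ℝ → ℝ), y 0 = -p ∧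
      (∀ x ≥ 0, y x ∈ Icc (-p) 0) ∧ (∀ x ≥ 0, Q x ∈ Icc 0 B) ∧
      (∀ x ≥ 0, 0 ≤ LF C (y x) + θ * x * y x + α * Q x) ∧
      (∀ x ≥ 0, ∀ x' ≥ x, y x ≤ y x') ∧
      (∀ x ≥ 0, ∀ x' ≥ x, y x * (x' - x) ≤ Q x' - Q x ∧ Q x' - Q x ≤ y x' * (x' - x)) ∧
      (∀ x ≥ 0, ∀ x' ≥ x,
        (LF C (y x) + θ * x' * y x + α * Q x') / s * (x' - x) ≤ y x' - y x ∧
        y x' - y x ≤ (LF C (y x') + θ * x * y x' + α * Q x) / s * (x' - x)) := by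
  have hn0 : ∀ n : ℕ, (0:ℝ) ≤ (n:ℝ) + 1 := fun n => by positivity
  choose Q y hy0 hQ hy hg hyI hQI using fun n : ℕ =>
    bvp (G := FN C (n + 1)) (k := n + 1) (c := C 0) (s := s) (θ := θ) (α := α) (p := p)
      (N := (n:ℝ) + 1) (FN_lip hC (hn0 n)) (hn0 n) (FN_cont hC (hn0 n)) (FN_mono hC (hn0 n))
      (FN_lb hC (hn0 n)) (fun y h => FN_ub hC (hn0 n) h) hs hθ hα hp (by simp)
  set B := (s * p + C 0 + θ * p + α * p) / α
  let U : Ultrafilter ℕ := Filter.hyperfilter ℕ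
  have hU : (U : Filter ℕ) ≤ atTop := Nat.hyperfilter_le_atTop
  have hev : ∀ x ≥ (0:ℝ), ∀ᶠ n : ℕ in (U : Filter ℕ), x ∈ Icc (0:ℝ) ((n:ℝ) + 1) := fun x hx => by
    refine Filter.Eventually.filter_mono hU ?_
    filter_upwards [eventually_ge_atTop ⌈x⌉₊] with n hn
    refine ⟨hx, ?_⟩
    have := Nat.le_of_ceil_le hn
    linarith
  have hUC : ∀ (K : Set ℝ) (f : ℕ → ℝ), IsCompact K → (∀ᶠ n in (U : Filter ℕ), f n ∈ K) →
      ∃ l ∈ K, Tendsto f U (nhds l) := fun K f hK hf => by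
    have := hK.ultrafilter_le_nhds (U.map f) (by
      rw [Ultrafilter.coe_map]; exact le_principal_iff.2 hf)
    exact this
  have hQl : ∀ x, ∃ l, 0 ≤ x → l ∈ Icc 0 B ∧ Tendsto (fun n => Q n x) U (nhds l) := fun x => by
    by_cases hx : 0 ≤ x
    · obtain ⟨l, h1, h2⟩ := hUC (Icc 0 B) (fun n => Q n x) isCompact_Icc
        ((hev x hx).mono fun n hn => hQI n x hn)
      exact ⟨l, fun _ => ⟨h1, h2⟩⟩
    · exact ⟨0, fun h => absurd h hx⟩
  have hyl : ∀ x, ∃ l, 0 ≤ x → l ∈ Icc (-p) 0 ∧ Tendsto (fun n => y n x) U (nhds l) := fun x => by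
    by_cases hx : 0 ≤ x
    · obtain ⟨l, h1, h2⟩ := hUC (Icc (-p) 0) (fun n => y n x) isCompact_Icc
        ((hev x hx).mono fun n hn => hyI n x hn)
      exact ⟨l, fun _ => ⟨h1, h2⟩⟩
    · exact ⟨0, fun h => absurd h hx⟩
  choose q hq using hQl
  choose z hz using hyl
  have hF : ∀ x ≥ 0, Tendsto (fun n : ℕ => FN C ((n:ℝ) + 1) (y n x)) U (nhds (LF C (z x))) := fun x hx => by
    have h1 : Tendsto (fun n => LF C (y n x)) U (nhds (LF C (z x))) := by
      have hcw := LF_cont hC hlim (z x) (hz x hx).1.2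
      refine hcw.tendsto.comp (tendsto_nhdsWithin_iff.2 ⟨(hz x hx).2, ?_⟩)
      exact (hev x hx).mono fun n hn => (hyI n x hn).2
    have h2 : Tendsto (fun n : ℕ => C ((n:ℝ) + 1)) U (nhds 0) :=
      (hlim.comp (tendsto_atTop_add_const_right _ 1 tendsto_natCast_atTop_atTop)).mono_left hU
    have h3 := h1.sub h2
    rw [sub_zero] at h3
    refine tendsto_of_tendsto_of_tendsto_of_le_of_le' h3 h1 ?_ ?_
    · filter_upwards [hev x hx] with n hn
      have := LF_le_FN hC (hn0 n) (hyI n x hn).2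
      linarith
    · filter_upwards [hev x hx] with n hn
      exact FN_le_LF hC (hn0 n) (hyI n x hn).2
  have hmon : ∀ n : ℕ, ∀ x ≥ 0, ∀ x' ≥ x, x' ≤ (n:ℝ) + 1 → y n x ≤ y n x' := fun n x hx x' hx' hn => by
    have := mvt_lo (f := y n) (c := 0) hx'
      (fun r hr => hy n r ⟨hx.trans hr.1, hr.2.trans hn⟩)
      (fun r hr => div_nonneg (hg n r ⟨hx.trans hr.1.le, hr.2.le.trans hn⟩) hs.le)
    linarith
  have hanti : ∀ n : ℕ, ∀ x ≥ 0, ∀ x' ≥ x, x' ≤ (n:ℝ) + 1 → Q n x' ≤ Q n x := fun n x hx x' hx' hn => by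
    have := mvt_hi (f := Q n) (c := 0) hx'
      (fun r hr => hQ n r ⟨hx.trans hr.1, hr.2.trans hn⟩)
      (fun r hr => (hyI n r ⟨hx.trans hr.1.le, hr.2.le.trans hn⟩).2)
    linarith
  refine ⟨B, q, z, ?_, fun x hx => (hz x hx).1, fun x hx => (hq x hx).1, ?_, ?_, ?_, ?_⟩
  · have := (hz 0 le_rfl).2
    simp only [hy0] at this
    exact tendsto_nhds_unique this tendsto_const_nhds
  · intro x hx
    have h1 := ((hF x hx).add ((hz x hx).2.const_mul (θ * x))).add ((hq x hx).2.const_mul α)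
    exact ge_of_tendsto h1 ((hev x hx).mono fun n hn => hg n x hn)
  · intro x hx x' hx'
    refine le_of_tendsto_of_tendsto (hz x hx).2 (hz x' (le_trans hx hx')).2 ?_
    filter_upwards [hev x' (le_trans hx hx')] with n hn
    exact hmon n x hx x' hx' hn.2
  · intro x hx x' hx'
    have hx0 : 0 ≤ x' := le_trans hx hx'
    constructor
    · refine le_of_tendsto_of_tendsto ((hz x hx).2.mul_const _) ((hq x' hx0).2.sub (hq x hx).2) ?_
      filter_upwards [hev x' hx0] with n hn
      exact mvt_lo (f := Q n) hx' (fun r hr => hQ n r ⟨hx.trans hr.1, hr.2.trans hn.2⟩)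
        (fun r hr => hmon n x hx r hr.1.le (hr.2.le.trans hn.2))
    · refine le_of_tendsto_of_tendsto ((hq x' hx0).2.sub (hq x hx).2) ((hz x' hx0).2.mul_const _) ?_
      filter_upwards [hev x' hx0] with n hn
      exact mvt_hi (f := Q n) hx' (fun r hr => hQ n r ⟨hx.trans hr.1, hr.2.trans hn.2⟩)
        (fun r hr => hmon n r (hx.trans hr.1.le) x' hr.2.le hn.2)
  · intro x hx x' hx'
    have hx0 : 0 ≤ x' := le_trans hx hx'
    constructor
    · refine le_of_tendsto_of_tendsto ((((((hF x hx).add ((hz x hx).2.const_mul (θ * x'))).add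
        ((hq x' hx0).2.const_mul α))).div_const s).mul_const _) ((hz x' hx0).2.sub (hz x hx).2) ?_
      filter_upwards [hev x' hx0] with n hn
      refine mvt_lo (f := y n) hx' (fun r hr => hy n r ⟨hx.trans hr.1, hr.2.trans hn.2⟩)
        (fun r hr => ?_)
      have hr0 : 0 ≤ r := hx.trans hr.1.le
      have hm := hmon n x hx r hr.1.le (hr.2.le.trans hn.2)
      have hq1 := hanti n r hr0 x' hr.2.le hn.2
      have hyx := (hyI n x ⟨hx, le_trans hx' hn.2⟩).2
      have h1 := FN_mono hC (hn0 n) hm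
      have h2 : x' * y n x ≤ r * y n r := by
        have a1 := mul_le_mul_of_nonpos_right hr.2.le hyx
        have a2 := mul_le_mul_of_nonneg_left hm hr0
        linarith
      have h3 : θ * (x' * y n x) ≤ θ * (r * y n r) := by gcongr
      have h4 : α * Q n x' ≤ α * Q n r := by gcongr
      refine div_le_div_of_nonneg_right ?_ hs.le
      linarith
    · refine le_of_tendsto_of_tendsto ((hz x' hx0).2.sub (hz x hx).2)
        ((((((hF x' hx0).add ((hz x' hx0).2.const_mul (θ * x))).add
        ((hq x hx).2.const_mul α))).div_const s).mul_const _) ?_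
      filter_upwards [hev x' hx0] with n hn
      refine mvt_hi (f := y n) hx' (fun r hr => hy n r ⟨hx.trans hr.1, hr.2.trans hn.2⟩)
        (fun r hr => ?_)
      have hr0 : 0 ≤ r := hx.trans hr.1.le
      have hm := hmon n r hr0 x' hr.2.le hn.2
      have hq1 := hanti n x hx r hr.1.le (hr.2.le.trans hn.2)
      have hyx := (hyI n x' ⟨hx0, hn.2⟩).2
      have hyr := (hyI n r ⟨hr0, hr.2.le.trans hn.2⟩).2
      have h1 := FN_mono hC (hn0 n) hm
      have h2 : r * y n r ≤ x * y n x' := by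
        have a1 := mul_le_mul_of_nonpos_right hr.1.le hyr
        have a2 := mul_le_mul_of_nonneg_left hm hx
        linarith
      have h3 : θ * (r * y n r) ≤ θ * (x * y n x') := by gcongr
      have h4 : α * Q n r ≤ α * Q n x := by gcongr
      refine div_le_div_of_nonneg_right ?_ hs.le
      linarith

lemma cont_ext {f : ℝ → ℝ} {k : ℝ}
    (h : ∀ x ≥ 0, ∀ x' ≥ x, |f x' - f x| ≤ k * (x' - x)) : Continuous (fun x => f (max x 0)) := by
  have hk : 0 ≤ k := by
    have := (abs_nonneg _).trans (h 0 le_rfl 1 zero_le_one)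
    linarith
  have hl : LipschitzOnWith (Real.toNNReal k) f (Ici 0) := by
    refine LipschitzOnWith.of_dist_le_mul fun a ha b hb => ?_
    rw [Real.coe_toNNReal _ hk, Real.dist_eq, Real.dist_eq]
    rcases le_total a b with hab | hab
    · rw [abs_sub_comm, abs_sub_comm a b, abs_of_nonneg (sub_nonneg.2 hab)]
      exact h a ha b hab
    · rw [abs_of_nonneg (sub_nonneg.2 hab)]
      exact h b hb a hab
  exact hl.continuousOn.comp_continuous (by fun_prop) (fun x => mem_Ici.2 (le_max_right x 0))

lemma right_deriv {f L V : ℝ → ℝ} {x g : ℝ}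
    (h : ∀ x' ≥ x, L x' * (x' - x) ≤ f x' - f x ∧ f x' - f x ≤ V x' * (x' - x))
    (hL : Tendsto L (nhdsWithin x (Ioi x)) (nhds g)) (hV : Tendsto V (nhdsWithin x (Ioi x)) (nhds g)) :
    HasDerivWithinAt f g (Ioi x) x := by
  rw [hasDerivWithinAt_iff_tendsto_slope' (by simp)]
  refine tendsto_of_tendsto_of_tendsto_of_le_of_le' hL hV ?_ ?_
  · filter_upwards [self_mem_nhdsWithin] with x' hx'
    have hx : x < x' := hx'
    rw [slope_def_field, le_div_iff₀ (sub_pos.2 hx)]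
    exact (h x' hx.le).1
  · filter_upwards [self_mem_nhdsWithin] with x' hx'
    have hx : x < x' := hx'
    rw [slope_def_field, div_le_iff₀ (sub_pos.2 hx)]
    exact (h x' hx.le).2

lemma int_rep {f g : ℝ → ℝ} (hf : Continuous (fun x => f (max x 0))) (hg : Continuous g)
    (hd : ∀ x ≥ 0, HasDerivWithinAt f (g x) (Ioi x) x) {x : ℝ} (hx : 0 ≤ x) :
    f 0 + ∫ t in (0:ℝ)..x, g t = f x := by
  rw [intervalIntegral.integral_eq_sub_of_hasDeriv_right_of_le (f := f) hx ?_
    (fun t ht => hd t ht.1.le) (hg.intervalIntegrable _ _)]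
  · ring
  · refine hf.continuousOn.congr fun t ht => ?_
    simp [max_eq_left ht.1]

lemma y_neg {C : ℝ → ℝ} {s θ α p B : ℝ} {Q y : ℝ → ℝ} (hC : ∀ u ≥ 0, 0 ≤ C u)
    (hlim : Tendsto C atTop (nhds 0)) (hs : 0 < s) (hθ : 0 < θ) (hα : 0 < α) (hp : 0 < p)
    (hy0 : y 0 = -p) (hcy : Continuous (fun x => y (max x 0)))
    (hyI : ∀ x ≥ 0, y x ∈ Icc (-p) 0) (hQI : ∀ x ≥ 0, Q x ∈ Icc 0 B)
    (hg : ∀ x ≥ 0, 0 ≤ LF C (y x) + θ * x * y x + α * Q x)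
    (hmon : ∀ x ≥ 0, ∀ x' ≥ x, y x ≤ y x')
    (hQ : ∀ x ≥ 0, ∀ x' ≥ x, y x * (x' - x) ≤ Q x' - Q x ∧ Q x' - Q x ≤ y x' * (x' - x))
    (hy : ∀ x ≥ 0, ∀ x' ≥ x,
        (LF C (y x) + θ * x' * y x + α * Q x') / s * (x' - x) ≤ y x' - y x ∧
        y x' - y x ≤ (LF C (y x') + θ * x * y x' + α * Q x) / s * (x' - x)) :
    ∀ x ≥ 0, y x < 0 := by
  by_contra hcon
  push Not at hcon
  obtain ⟨x1, hx1, hyx1⟩ := hcon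
  have hcl : IsClosed (Icc 0 x1 ∩ (fun x => y (max x 0)) ⁻¹' (Ici 0)) :=
    isClosed_Icc.inter (isClosed_Ici.preimage hcy)
  have hcomp : IsCompact (Icc 0 x1 ∩ (fun x => y (max x 0)) ⁻¹' (Ici 0)) :=
    isCompact_Icc.of_isClosed_subset hcl inter_subset_left
  obtain ⟨τ, ⟨hτ, hyτ⟩, hmin⟩ := hcomp.exists_isLeast
    ⟨x1, ⟨hx1, le_rfl⟩, by simpa [max_eq_left hx1] using hyx1⟩
  have hyτ' : 0 ≤ y τ := by simpa [max_eq_left hτ.1] using hyτ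
  have hyτ0 : y τ = 0 := le_antisymm (hyI τ hτ.1).2 hyτ'
  have hτ0 : 0 < τ := lt_of_le_of_ne hτ.1 (by rintro rfl; linarith)
  have hlt : ∀ x ∈ Ico 0 τ, y x < 0 := fun x hx => by
    by_contra hh
    have := hmin (⟨⟨hx.1, hx.2.le.trans hτ.2⟩, by simpa [max_eq_left hx.1] using hh⟩ :
      x ∈ Icc 0 x1 ∩ (fun x => y (max x 0)) ⁻¹' (Ici 0))
    linarith [hx.2]
  have hτ1 : 0 ≤ τ + 1 := by linarith
  have hy1 : y (τ + 1) = 0 :=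
    le_antisymm (hyI _ hτ1).2 (hyτ0 ▸ hmon τ hτ.1 (τ + 1) (by linarith))
  have hQ1 : Q (τ + 1) ≤ 0 := by
    have := (hy τ hτ.1 (τ + 1) (by linarith)).1
    rw [hy1, hyτ0, LF_zero hC hlim] at this
    have h2 : α * Q (τ + 1) / s ≤ 0 := by simpa using this
    by_contra hh
    push Not at hh
    have : 0 < α * Q (τ + 1) / s := by positivity
    linarith
  have hQτ : Q τ ≤ 0 := by
    have := (hQ τ hτ.1 (τ + 1) (by linarith)).1
    rw [hyτ0] at this
    linarith
  obtain ⟨x, hx⟩ : ∃ x, x = τ * (α + θ / 2) / (α + θ) := ⟨_, rfl⟩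
  have hx' : x * (α + θ) = τ * (α + θ / 2) := by rw [hx]; field_simp
  have hx0 : 0 ≤ x := by rw [hx]; positivity
  have hxτ : x < τ := by
    rw [hx, div_lt_iff₀ (by positivity)]
    nlinarith
  have hyx := hlt x ⟨hx0, hxτ⟩
  have h1 := (hQ x hx0 τ hxτ.le).1
  have h2 := hg x hx0
  have h3 := LF_ub hC hyx.le
  have h4 : α * Q x ≤ α * (-(y x * (τ - x))) := by gcongr; linarith
  have h5 : 0 ≤ y x * (θ * τ / 2) := by
    have : θ * x - α * (τ - x) = θ * τ / 2 := by linarith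
    rw [← this]; linarith
  have h6 : y x * (θ * τ / 2) < 0 := mul_neg_of_neg_of_pos hyx (by positivity)
  linarith

/-- There exists a bounded, twice continuously differentiable function `Q` on `[0,∞)` that is
non-negative, strictly decreasing, convex, has derivative bounded in `[-M, 0)`, satisfies
`Q'(0) = -p` and the equation `(σ²/2)Q'' − F(Q') − θxQ' − αQ = 0`, and consequently satisfies
the HJB equation `inf_{u ≥ 0} {(σ²/2)Q'' − uQ' + C(u) − θxQ' − αQ} = 0` on `[0,∞)`. -/
theorem statement0
    (C : ℝ → ℝ) (σ θ α p : ℝ)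
    (hσ : 0 < σ) (hθ : 0 < θ) (hα : 0 < α) (hp : 0 < p)
    (hC2 : ContDiff ℝ 2 C)
    (hCanti : AntitoneOn C (Set.Ici 0))
    (hCconv : ConvexOn ℝ (Set.Ici 0) C)
    (hC0 : 0 < C 0)
    (hClim : Tendsto C atTop (nhds 0))
    (hC'' : ∀ u ≥ (0 : ℝ), 0 < deriv (deriv C) u)
    (hC'0 : deriv C 0 < 0) :
    ∃ Q : ℝ → ℝ,
      ContDiff ℝ 2 Q ∧
      (∃ B : ℝ, ∀ x ≥ (0 : ℝ), |Q x| ≤ B) ∧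
      (∀ x ≥ (0 : ℝ), 0 ≤ Q x) ∧
      StrictAntiOn Q (Set.Ici 0) ∧
      ConvexOn ℝ (Set.Ici 0) Q ∧
      (∃ M : ℝ, 0 < M ∧ ∀ x ≥ (0 : ℝ), -M ≤ deriv Q x ∧ deriv Q x < 0) ∧
      deriv Q 0 = -p ∧
      (∀ x ≥ (0 : ℝ),
        σ ^ 2 / 2 * deriv (deriv Q) x - LF C (deriv Q x) - θ * x * deriv Q x - α * Q x = 0) ∧
      (∀ x ≥ (0 : ℝ),
        sInf {z : ℝ | ∃ u ≥ (0 : ℝ),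
          z = σ ^ 2 / 2 * deriv (deriv Q) x - u * deriv Q x + C u
              - θ * x * deriv Q x - α * Q x} = 0) := by
  have hC : ∀ u ≥ 0, 0 ≤ C u := fun u hu => by
    refine le_of_tendsto hClim ?_
    filter_upwards [eventually_ge_atTop u] with v hv
    exact hCanti hu (le_trans hu hv : (0:ℝ) ≤ v) hv
  have hs : 0 < σ ^ 2 / 2 := by positivity
  obtain ⟨B, Q, y, hy0, hyI, hQI, hg, hmon, hQ, hy⟩ :=
    limit_exists (s := σ ^ 2 / 2) hC hClim hs hθ hα hp
  generalize σ ^ 2 / 2 = s at *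
  have hB : 0 ≤ B := (hQI 0 le_rfl).1.trans (hQI 0 le_rfl).2
  have hcy : Continuous (fun x => y (max x 0)) := by
    refine cont_ext (k := α * B / s) fun x hx x' hx' => ?_
    have hx0 : 0 ≤ x' := le_trans hx hx'
    rw [abs_of_nonneg (sub_nonneg.2 (hmon x hx x' hx'))]
    refine (hy x hx x' hx').2.trans ?_
    have h1 := LF_ub hC (hyI x' hx0).2
    have h2 : θ * x * y x' ≤ 0 :=
      mul_nonpos_of_nonneg_of_nonpos (mul_nonneg hθ.le hx) (hyI x' hx0).2
    have h3 : α * Q x ≤ α * B := mul_le_mul_of_nonneg_left (hQI x hx).2 hα.le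
    have h4 : 0 ≤ x' - x := sub_nonneg.2 hx'
    refine mul_le_mul_of_nonneg_right (div_le_div_of_nonneg_right ?_ hs.le) h4
    linarith
  have hcQ : Continuous (fun x => Q (max x 0)) := by
    refine cont_ext (k := p) fun x hx x' hx' => ?_
    have hx0 : 0 ≤ x' := le_trans hx hx'
    have h4 : 0 ≤ x' - x := sub_nonneg.2 hx'
    have h5 := hQ x hx x' hx'
    have h6 := mul_le_mul_of_nonneg_right (hyI x hx).1 h4
    have h7 := mul_le_mul_of_nonneg_right (hyI x' hx0).2 h4
    have h8 := mul_nonneg hp.le h4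
    rw [abs_le]; constructor <;> linarith
  have hyneg := y_neg hC hClim hs hθ hα hp hy0 hcy hyI hQI hg hmon hQ hy
  have hcF : Continuous (fun x => LF C (y (max x 0))) :=
    (LF_cont hC hClim).comp_continuous hcy (fun x => (hyI _ (le_max_right _ _)).2)
  obtain ⟨g, hgdef⟩ : ∃ g : ℝ → ℝ, g = fun x =>
    (LF C (y (max x 0)) + θ * (max x 0) * y (max x 0) + α * Q (max x 0)) / s := ⟨_, rfl⟩
  have hgc : Continuous g := by 
    rw [hgdef]
    exact (((hcF.add ((continuous_const.mul (continuous_id.max continuous_const)).mul hcy)).add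
      (continuous_const.mul hcQ))).div_const s
  have hgx : ∀ x ≥ 0, g x = (LF C (y x) + θ * x * y x + α * Q x) / s := fun x hx => by
    rw [hgdef]; simp only [max_eq_left hx]
  have hcongr : ∀ (f : ℝ → ℝ) (x : ℝ), 0 ≤ x →
      (fun x' => f (max x' 0)) =ᶠ[nhdsWithin x (Ioi x)] f := fun f x hx => by
    filter_upwards [self_mem_nhdsWithin] with x' hx'
    have h : x < x' := hx'
    simp only [max_eq_left (hx.trans h.le)]
  have hrt : ∀ (f : ℝ → ℝ), Continuous (fun x => f (max x 0)) → ∀ x ≥ 0,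
      Tendsto f (nhdsWithin x (Ioi x)) (nhds (f x)) := fun f hf x hx => by
    have h1 := (hf.tendsto x).mono_left (nhdsWithin_le_nhds (s := Ioi x))
    simp only [max_eq_left hx] at h1
    exact h1.congr' (hcongr f x hx)
  have hid : ∀ x : ℝ, Tendsto (fun t : ℝ => t) (nhdsWithin x (Ioi x)) (nhds x) := fun x =>
    tendsto_id.mono_left nhdsWithin_le_nhds
  have hdQ : ∀ x ≥ 0, HasDerivWithinAt Q (y (max x 0)) (Ioi x) x := fun x hx => by
    rw [max_eq_left hx]
    exact right_deriv (L := fun _ => y x) (V := y) (fun x' hx' => hQ x hx x' hx')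
      tendsto_const_nhds (hrt y hcy x hx)
  have hdy : ∀ x ≥ 0, HasDerivWithinAt y (g x) (Ioi x) x := fun x hx => by
    rw [hgx x hx]
    refine right_deriv (L := fun x' => (LF C (y x) + θ * x' * y x + α * Q x') / s)
      (V := fun x' => (LF C (y x') + θ * x * y x' + α * Q x) / s)
      (fun x' hx' => hy x hx x' hx') ?_ ?_
    · exact (((tendsto_const_nhds.add (((hid x).const_mul θ).mul_const (y x))).add
        ((hrt Q hcQ x hx).const_mul α))).div_const s
    · exact ((((hrt (fun x => LF C (y x)) hcF x hx).add ((hrt y hcy x hx).const_mul (θ * x))).add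
        tendsto_const_nhds)).div_const s
  obtain ⟨Y, hYdef⟩ : ∃ Y : ℝ → ℝ, Y = fun x => y 0 + ∫ t in (0:ℝ)..x, g t := ⟨_, rfl⟩
  have hYd : ∀ x, HasDerivAt Y (g x) x := fun x => by
    rw [hYdef]
    exact (hgc.integral_hasStrictDerivAt 0 x).hasDerivAt.const_add _
  have hYx : ∀ x ≥ 0, Y x = y x := fun x hx => by
    rw [hYdef]; exact int_rep hcy hgc hdy hx
  have hYc : Continuous Y := continuous_iff_continuousAt.2 fun x => (hYd x).continuousAt
  obtain ⟨q, hqdef⟩ : ∃ q : ℝ → ℝ, q = fun x => Q 0 + ∫ t in (0:ℝ)..x, Y t := ⟨_, rfl⟩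
  have hqd : ∀ x, HasDerivAt q (Y x) x := fun x => by
    rw [hqdef]
    exact (hYc.integral_hasStrictDerivAt 0 x).hasDerivAt.const_add _
  have hqx : ∀ x ≥ 0, q x = Q x := fun x hx => by
    rw [hqdef]
    exact int_rep hcQ hYc (fun t ht => by
      have := hdQ t ht
      rwa [max_eq_left ht, ← hYx t ht] at this) hx
  have hdq : deriv q = Y := funext fun x => (hqd x).deriv
  have hdY : deriv Y = g := funext fun x => (hYd x).deriv
  have hqdiff : Differentiable ℝ q := fun x => (hqd x).differentiableAt
  have hYdiff : Differentiable ℝ Y := fun x => (hYd x).differentiableAt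
  have heq : ∀ x ≥ (0:ℝ), s * g x - LF C (y x) - θ * x * y x - α * Q x = 0 := fun x hx => by
    rw [hgx x hx]; field_simp; ring
  refine ⟨q, ?_, ⟨B, fun x hx => ?_⟩, fun x hx => ?_, ?_, ?_, ⟨p, hp, fun x hx => ?_⟩, ?_, ?_, ?_⟩
  · rw [show (2 : WithTop ℕ∞) = 1 + 1 from by norm_num, contDiff_succ_iff_deriv]
    refine ⟨hqdiff, by simp, ?_⟩
    rw [hdq, contDiff_one_iff_deriv, hdY]
    exact ⟨hYdiff, hgc⟩
  · rw [hqx x hx, abs_of_nonneg (hQI x hx).1]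
    exact (hQI x hx).2
  · rw [hqx x hx]; exact (hQI x hx).1
  · refine strictAntiOn_of_deriv_neg (convex_Ici 0) hqdiff.continuous.continuousOn fun x hx => ?_
    have hx0 : 0 ≤ x := interior_subset hx
    rw [hdq, hYx x hx0]
    exact hyneg x hx0
  · refine MonotoneOn.convexOn_of_deriv (convex_Ici 0) hqdiff.continuous.continuousOn
      hqdiff.differentiableOn fun a ha b hb hab => ?_
    have ha0 : 0 ≤ a := interior_subset ha
    rw [hdq, hYx a ha0, hYx b (ha0.trans hab)]
    exact hmon a ha0 b hab
  · rw [hdq, hYx x hx]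
    exact ⟨(hyI x hx).1, hyneg x hx⟩
  · rw [hdq, hYx 0 le_rfl, hy0]
  · intro x hx
    rw [hdq, hdY, hYx x hx, hqx x hx]
    exact heq x hx
  · intro x hx
    rw [hdq, hdY, hYx x hx, hqx x hx]
    have he := heq x hx
    have hyx := (hyI x hx).2
    apply IsGLB.csInf_eq
    · constructor
      · rintro z ⟨u, hu, rfl⟩
        have := le_LF hC hyx hu
        linarith
      · intro b hb
        have h1 : LF C (y x) ≤ LF C (y x) - b := LF_le fun u hu => by
          have := hb ⟨u, hu, rfl⟩
          linarith
        linarith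
    · exact ⟨_, 0, le_rfl, rfl⟩
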